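/- Assume 0 < P(W = +1) < 1, P(Y = +1) > 0 and P(Y = +1, Z = +1) > 0. Then for every bounded measurable surrogate loss ℓ : ℝ → ℝ and every measurable g : 𝒳 → ℝ, the surrogate classification risk R(g) = α · E_{W=+1}[ℓ(g(X))] + (1 − α) · E_{W=−1}[ℓ(−g(X))] satisfies R(g) = β · E_{Y=+1}[ℓ(g(X))] − γ · E_{(Y,Z)=(+1,+1)}[ℓ(g(X))] + E[ℓ(−g(X))] − β · E_{Y=+1}[ℓ(−g(X))] + γ · E_{(Y,Z)=(+1,+1)}[ℓ(−g(X))], where E[·] is the unconditional expectation. -/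

import Mathlib

open MeasureTheory ProbabilityTheory

/-- Multiplying a conditional expectation by the probability of the event gives the integral over
the event; this holds for null events too, both sides then being zero. -/
theorem measure_toReal_mul_integral_cond {Ω : Type*} [MeasurableSpace Ω] (P : Measure Ω)
    [IsFiniteMeasure P] (s : Set Ω) (f : Ω → ℝ) :
    (P s).toReal * ∫ ω, f ω ∂(P[|s]) = ∫ ω in s, f ω ∂P := by
  by_cases h : P s = 0
  · simp [h, Measure.restrict_eq_zero.2 h]
  · have h' : (P s).toReal ≠ 0 := ENNReal.toReal_ne_zero.2 ⟨h, measure_ne_top P s⟩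
    rw [ProbabilityTheory.cond, integral_smul_measure, ENNReal.toReal_inv, smul_eq_mul,
      mul_inv_cancel_left₀ h']

/-- Assume `0 < P(W = +1) < 1`, `P(Y = +1) > 0` and `P(Y = +1, Z = +1) > 0`.
Then for every bounded measurable surrogate loss `ℓ : ℝ → ℝ` and every measurable
`g : 𝒳 → ℝ`, the surrogate risk `R(g) = α·E_{W=+1}[ℓ(g(X))] + (1−α)·E_{W=−1}[ℓ(−g(X))]`
satisfies
`R(g) = β·E_{Y=+1}[ℓ(g(X))] − γ·E_{(Y,Z)=(+1,+1)}[ℓ(g(X))] + E[ℓ(−g(X))]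
  − β·E_{Y=+1}[ℓ(−g(X))] + γ·E_{(Y,Z)=(+1,+1)}[ℓ(−g(X))]`. -/
theorem double_pu_surrogate_risk_identity
    {Ω 𝓧 : Type*} [MeasurableSpace Ω] [MeasurableSpace 𝓧]
    (P : Measure Ω) [IsProbabilityMeasure P]
    (X : Ω → 𝓧) (Y Z W : Ω → ℤ)
    (hX : Measurable X) (hY : Measurable Y) (hZ : Measurable Z)
    (hYval : ∀ ω, Y ω = 1 ∨ Y ω = -1) (hZval : ∀ ω, Z ω = 1 ∨ Z ω = -1)
    (hW : ∀ ω, W ω = if Y ω = 1 ∧ Z ω = -1 then 1 else -1)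
    (hα0 : 0 < P {ω | W ω = 1}) (hα1 : P {ω | W ω = 1} < 1)
    (hβ : 0 < P {ω | Y ω = 1})
    (hγ : 0 < P ({ω | Y ω = 1} ∩ {ω | Z ω = 1}))
    (ℓ : ℝ → ℝ) (hℓ : Measurable ℓ) (C : ℝ) (hbd : ∀ z, |ℓ z| ≤ C)
    (g : 𝓧 → ℝ) (hg : Measurable g) :
    (P {ω | W ω = 1}).toReal * ∫ ω, ℓ (g (X ω)) ∂(P[|{ω | W ω = 1}])
      + (1 - (P {ω | W ω = 1}).toReal) * ∫ ω, ℓ (-(g (X ω))) ∂(P[|{ω | W ω = -1}])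
    = (P {ω | Y ω = 1}).toReal * ∫ ω, ℓ (g (X ω)) ∂(P[|{ω | Y ω = 1}])
      - (P ({ω | Y ω = 1} ∩ {ω | Z ω = 1})).toReal
          * ∫ ω, ℓ (g (X ω)) ∂(P[|({ω | Y ω = 1} ∩ {ω | Z ω = 1})])
      + ∫ ω, ℓ (-(g (X ω))) ∂P
      - (P {ω | Y ω = 1}).toReal * ∫ ω, ℓ (-(g (X ω))) ∂(P[|{ω | Y ω = 1}])
      + (P ({ω | Y ω = 1} ∩ {ω | Z ω = 1})).toReal
          * ∫ ω, ℓ (-(g (X ω))) ∂(P[|({ω | Y ω = 1} ∩ {ω | Z ω = 1})]) := by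
  have hA : MeasurableSet {ω | Y ω = 1} := hY (measurableSet_singleton 1)
  have hB : MeasurableSet {ω | Z ω = 1} := hZ (measurableSet_singleton 1)
  have hpos : {ω | W ω = 1} = {ω | Y ω = 1} \ {ω | Z ω = 1} := by
    ext ω
    have := hW ω
    rcases hYval ω with h | h <;> rcases hZval ω with h' | h' <;> simp_all
  have hneg : {ω | W ω = -1} = {ω | W ω = 1}ᶜ := by
    ext ω
    have := hW ω
    rcases hYval ω with h | h <;> rcases hZval ω with h' | h' <;> simp_all
  have hWm : MeasurableSet {ω | W ω = 1} := hpos ▸ hA.diff hB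
  have hcompl : 1 - (P {ω | W ω = 1}).toReal = (P {ω | W ω = -1}).toReal := by
    rw [hneg]
    exact (probReal_compl_eq_one_sub hWm).symm
  have hint : ∀ u : Ω → ℝ, Measurable u → Integrable (fun ω => ℓ (u ω)) P := fun u hu =>
    Integrable.of_bound (hℓ.comp hu).aestronglyMeasurable C (ae_of_all _ fun ω => hbd (u ω))
  have hi := hint _ (hg.comp hX)
  have hi' := hint _ (hg.comp hX).neg
  have split : ∀ f : Ω → ℝ, Integrable f P →
      ∫ ω in {ω | Y ω = 1} ∩ {ω | Z ω = 1}, f ω ∂P + ∫ ω in {ω | W ω = 1}, f ω ∂P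
        = ∫ ω in {ω | Y ω = 1}, f ω ∂P := fun f hf => by
    rw [hpos]
    exact integral_inter_add_sdiff hB hf.integrableOn
  have h₁ := split _ hi
  have h₂ := split _ hi'
  have h₃ := integral_add_compl hWm hi'
  simp only [hcompl, measure_toReal_mul_integral_cond]
  rw [hneg]
  simp only [Function.comp_apply, Pi.neg_apply] at h₁ h₂ h₃
  linarith
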